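/- arXiv:1501.05676 — 2 statements merged into one kernel-verified Lean document; each statement's English description precedes it below -/
import Mathlib

section
/- Let G be a group, A a subgroup of G, and x, y ∈ G with y ∈ A·A^x. Then the following three conditions are equivalent: (a) G = A·A^x·A^y; (b) G = (AzA)(AwA) where z = x⁻¹ and w = xy⁻¹; (c) G = A·A^x·A, which in turn equals the condition G = (Ax⁻¹A)(AxA). -/
open Pointwise

/-- The conjugate `x⁻¹ A x` of a set `A` by an element `x`. -/
def conjSet {G : Type*} [Group G] (A : Set G) (x : G) : Set G :=
  (fun a => x⁻¹ * a * x) '' A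

/-- The double coset `A x A` of a set `A` and an element `x`. -/
def dcoset {G : Type*} [Group G] (A : Set G) (x : G) : Set G :=
  A * {x} * A

theorem conjSet_eq_aux {G : Type*} [Group G] (A : Set G) (x : G) :
    conjSet A x = {x⁻¹} * A * {x} := by
  simp only [conjSet, Set.singleton_mul, Set.mul_singleton, Set.image_image]

theorem dcoset_mul_aux {G : Type*} [Group G] (A : Subgroup G) (x : G) :
    dcoset (A : Set G) x⁻¹ * dcoset (A : Set G) x
      = (A : Set G) * conjSet (A : Set G) x * (A : Set G) := by
  rw [conjSet_eq_aux, dcoset, dcoset]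
  have h : (A : Set G) * (A : Set G) = A := coe_mul_coe A
  calc (A : Set G) * {x⁻¹} * A * (A * {x} * A)
      = A * {x⁻¹} * (A * A) * {x} * A := by simp only [mul_assoc]
    _ = A * ({x⁻¹} * A * {x}) * A := by rw [h]; simp only [mul_assoc]

theorem dcoset_congr_aux {G : Type*} [Group G] (A : Subgroup G) (x a b : G)
    (ha : a ∈ A) (hb : b ∈ A) :
    dcoset (A : Set G) (b * x * a) = dcoset (A : Set G) x := by
  have h1 : (A : Set G) * {b} = A := by
    ext g
    simp [Set.mul_singleton, A.mul_mem_cancel_right (inv_mem hb)]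
  have h2 : {a} * (A : Set G) = A := by
    ext g
    simp [Set.singleton_mul, A.mul_mem_cancel_left (inv_mem ha)]
  calc (A : Set G) * {b * x * a} * A = (A * {b}) * {x} * ({a} * A) := by
        simp only [← Set.singleton_mul_singleton, mul_assoc]
    _ = A * {x} * A := by rw [h1, h2]

theorem conj_prod_aux {G : Type*} [Group G] (A : Subgroup G) (x a b : G)
    (ha : a ∈ A) (hb : b ∈ A) :
    (A : Set G) * conjSet (A : Set G) x * conjSet (A : Set G) (a * (x⁻¹ * b * x))
      = (A : Set G) * conjSet (A : Set G) x * (A : Set G) * {x⁻¹ * b * x} := by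
  have h1 : (A : Set G) * {b⁻¹} = A := by
    ext g
    simp [Set.mul_singleton, A.mul_mem_cancel_right hb]
  have h2 : {a⁻¹} * (A : Set G) * {a} = A := by
    ext g
    simp [Set.singleton_mul, Set.mul_singleton, A.mul_mem_cancel_left ha,
      A.mul_mem_cancel_right (inv_mem ha)]
  have e : (a * (x⁻¹ * b * x))⁻¹ = x⁻¹ * b⁻¹ * x * a⁻¹ := by group
  have hx : ({x} : Set G) * {x⁻¹ * b⁻¹ * x * a⁻¹} = {b⁻¹} * {x} * {a⁻¹} := by
    simp [mul_assoc]
  rw [conjSet_eq_aux, conjSet_eq_aux, e]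
  calc (A : Set G) * ({x⁻¹} * A * {x})
        * ({x⁻¹ * b⁻¹ * x * a⁻¹} * A * {a * (x⁻¹ * b * x)})
      = A * {x⁻¹} * A * ({x} * {x⁻¹ * b⁻¹ * x * a⁻¹}) * A * {a * (x⁻¹ * b * x)} := by
        simp only [mul_assoc]
    _ = A * {x⁻¹} * (A * {b⁻¹}) * {x} * ({a⁻¹} * A * {a}) * {x⁻¹ * b * x} := by
        rw [hx, ← Set.singleton_mul_singleton (a := a)]; simp only [mul_assoc]
    _ = A * ({x⁻¹} * A * {x}) * A * {x⁻¹ * b * x} := by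
        rw [h1, h2]; simp only [mul_assoc]

theorem mul_singleton_univ_aux {G : Type*} [Group G] (S : Set G) (g : G) :
    S * {g} = Set.univ ↔ S = Set.univ := by
  constructor
  · intro h
    have : S = S * {g} * {g⁻¹} := by
      rw [mul_assoc, Set.singleton_mul_singleton, mul_inv_cancel, Set.singleton_one, mul_one]
    rw [this, h]
    exact Set.eq_univ_of_forall fun t => ⟨t * g, trivial, g⁻¹, rfl, by simp⟩
  · rintro rfl
    exact Set.eq_univ_of_forall fun t => ⟨t * g⁻¹, trivial, g, rfl, by simp⟩

/-- If `y ∈ A·Aˣ` then the following are equivalent: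
(a) `G = A·Aˣ·Aʸ`; (b) `G = (AzA)(AwA)` with `z = x⁻¹`, `w = x y⁻¹`;
(c) `G = A·Aˣ·A`, which in turn is equivalent to `G = (Ax⁻¹A)(AxA)`. -/
theorem prod_three_conj_tfae {G : Type*} [Group G] (A : Subgroup G) (x y : G)
    (hy : y ∈ (A : Set G) * conjSet (A : Set G) x) :
    ((A : Set G) * conjSet (A : Set G) x * conjSet (A : Set G) y = Set.univ ↔
        dcoset (A : Set G) x⁻¹ * dcoset (A : Set G) (x * y⁻¹) = Set.univ) ∧
    (dcoset (A : Set G) x⁻¹ * dcoset (A : Set G) (x * y⁻¹) = Set.univ ↔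
        (A : Set G) * conjSet (A : Set G) x * (A : Set G) = Set.univ) ∧
    ((A : Set G) * conjSet (A : Set G) x * (A : Set G) = Set.univ ↔
        dcoset (A : Set G) x⁻¹ * dcoset (A : Set G) x = Set.univ) := by
  obtain ⟨a, ha, c, ⟨b, hb, rfl⟩, rfl⟩ := hy
  have hd : dcoset (A : Set G) (x * (a * (x⁻¹ * b * x))⁻¹) = dcoset (A : Set G) x := by
    rw [← dcoset_congr_aux A x a⁻¹ b⁻¹ (inv_mem ha) (inv_mem hb)]
    congr 1
    group
  have hp := conj_prod_aux A x a b ha hb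
  dsimp only
  rw [hd, hp, dcoset_mul_aux, mul_singleton_univ_aux]
  exact ⟨Iff.rfl, Iff.rfl, Iff.rfl⟩
end

section
/- Let G be a group with a BN-pair with Weyl group W. For all w ∈ W and i ∈ I: if ℓ(w s_i) = ℓ(w) + 1 then (BwB)(Bs_iB) = B(ws_i)B, while if ℓ(w s_i) = ℓ(w) − 1 then (BwB)(Bs_iB) = B(ws_i)B ∪ BwB. Analogously, if ℓ(s_i w) = ℓ(w) + 1 then (Bs_iB)(BwB) = B(s_iw)B, while if ℓ(s_i w) = ℓ(w) − 1 then (Bs_iB)(BwB) = B(s_iw)B ∪ BwB. -/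
open Pointwise

/-- The length of `w` with respect to a generating set `S`: the least number of
factors in an expression of `w` as a product of elements of `S` (`0` for `w = 1`). -/
noncomputable def wordLength {W : Type*} [Monoid W] (S : Set W) (w : W) : ℕ :=
  sInf {k | ∃ l : List W, (∀ x ∈ l, x ∈ S) ∧ l.length = k ∧ l.prod = w}

section WL
variable {W : Type*} [Group W] {I : Type*} {s : I → W}

theorem wl_exists (axGen : Subgroup.closure (Set.range s) = ⊤) (axSq : ∀ i, s i * s i = 1) (w : W) :
    ∃ l : List W, (∀ x ∈ l, x ∈ Set.range s) ∧ l.length = wordLength (Set.range s) w ∧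
      l.prod = w := by
  have hinv : (Set.range s)⁻¹ = Set.range s := by
    have h : ∀ i, (s i)⁻¹ = s i := fun i => inv_eq_of_mul_eq_one_left (axSq i)
    ext x
    simp only [Set.mem_inv, Set.mem_range]
    constructor
    · rintro ⟨i, hi⟩
      exact ⟨i, by rw [← h i, hi, inv_inv]⟩
    · rintro ⟨i, rfl⟩
      exact ⟨i, (h i).symm⟩
  have hne : {k | ∃ l : List W, (∀ x ∈ l, x ∈ Set.range s) ∧ l.length = k ∧ l.prod = w}.Nonempty := by
    have hw : w ∈ (Subgroup.closure (Set.range s)).toSubmonoid := by rw [axGen]; trivial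
    rw [Subgroup.closure_toSubmonoid, hinv, Set.union_self] at hw
    obtain ⟨l, hl, hp⟩ := Submonoid.exists_list_of_mem_closure hw
    exact ⟨_, l, hl, rfl, hp⟩
  exact Nat.sInf_mem hne

theorem wl_le (l : List W) (hl : ∀ x ∈ l, x ∈ Set.range s) :
    wordLength (Set.range s) l.prod ≤ l.length :=
  Nat.sInf_le ⟨l, hl, rfl, rfl⟩

theorem wl_zero (axGen : Subgroup.closure (Set.range s) = ⊤) (axSq : ∀ i, s i * s i = 1) {w : W}
    (h : wordLength (Set.range s) w = 0) : w = 1 := by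
  obtain ⟨l, _, h2, h3⟩ := wl_exists axGen axSq w
  rw [h, List.length_eq_zero_iff] at h2
  subst h2
  simpa using h3.symm

theorem wl_mul_left (axGen : Subgroup.closure (Set.range s) = ⊤) (axSq : ∀ i, s i * s i = 1)
    (i : I) (w : W) :
    wordLength (Set.range s) (s i * w) ≤ wordLength (Set.range s) w + 1 := by
  obtain ⟨l, h1, h2, h3⟩ := wl_exists axGen axSq w
  have := wl_le (s := s) (s i :: l) (by
    intro x hx
    rcases List.mem_cons.1 hx with rfl | hx
    · exact ⟨i, rfl⟩
    · exact h1 x hx)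
  simpa [h2, h3] using this

theorem wl_inv_le (axGen : Subgroup.closure (Set.range s) = ⊤) (axSq : ∀ i, s i * s i = 1)
    (w : W) : wordLength (Set.range s) w⁻¹ ≤ wordLength (Set.range s) w := by
  obtain ⟨l, h1, h2, h3⟩ := wl_exists axGen axSq w
  have := wl_le (s := s) (l.map (·⁻¹)).reverse (by
    intro x hx
    simp only [List.mem_reverse, List.mem_map] at hx
    obtain ⟨y, hy, rfl⟩ := hx
    obtain ⟨i, rfl⟩ := h1 y hy
    exact ⟨i, (inv_eq_of_mul_eq_one_left (axSq i)).symm⟩)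
  rw [← List.prod_inv_reverse, h3] at this
  simpa [h2] using this

theorem wl_inv (axGen : Subgroup.closure (Set.range s) = ⊤) (axSq : ∀ i, s i * s i = 1)
    (w : W) : wordLength (Set.range s) w⁻¹ = wordLength (Set.range s) w := by
  apply le_antisymm (wl_inv_le axGen axSq w)
  simpa using wl_inv_le axGen axSq w⁻¹

theorem wl_mul_right (axGen : Subgroup.closure (Set.range s) = ⊤) (axSq : ∀ i, s i * s i = 1)
    (i : I) (w : W) :
    wordLength (Set.range s) (w * s i) ≤ wordLength (Set.range s) w + 1 := by
  rw [← wl_inv axGen axSq (w * s i), ← wl_inv axGen axSq w, mul_inv_rev,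
    inv_eq_of_mul_eq_one_left (axSq i)]
  exact wl_mul_left axGen axSq i _

theorem wl_succ (axGen : Subgroup.closure (Set.range s) = ⊤) (axSq : ∀ i, s i * s i = 1) {w : W}
    {k : ℕ} (h : wordLength (Set.range s) w = k + 1) :
    ∃ i, wordLength (Set.range s) (s i * w) = k := by
  obtain ⟨l, h1, h2, h3⟩ := wl_exists axGen axSq w
  rw [h] at h2
  match l, h1, h2, h3 with
  | x :: l, h1, h2, h3 =>
    obtain ⟨i, rfl⟩ := h1 x (by simp)
    have e : s i * w = l.prod := by rw [← h3, List.prod_cons, ← mul_assoc, axSq, one_mul]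
    refine ⟨i, ?_⟩
    have h4 := wl_le (s := s) l (fun x hx => h1 x (by simp [hx]))
    have h5 := wl_mul_left axGen axSq i (s i * w)
    rw [← mul_assoc, axSq, one_mul, h] at h5
    rw [← e] at h4
    simp at h2
    omega

theorem wl_succ_right (axGen : Subgroup.closure (Set.range s) = ⊤) (axSq : ∀ i, s i * s i = 1)
    {w : W} {k : ℕ} (h : wordLength (Set.range s) w = k + 1) :
    ∃ i, wordLength (Set.range s) (w * s i) = k := by
  rw [← wl_inv axGen axSq] at h
  obtain ⟨i, hi⟩ := wl_succ axGen axSq h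
  refine ⟨i, ?_⟩
  rw [← wl_inv axGen axSq, mul_inv_rev, inv_eq_of_mul_eq_one_left (axSq i), hi]
end WL

/-- `y` lies in the double coset `B x B`. -/
def DCRel {G : Type*} [Group G] (B : Subgroup G) (x y : G) : Prop :=
  ∃ b ∈ B, ∃ c ∈ B, y = b * x * c

section DC
variable {G : Type*} [Group G] {B : Subgroup G} {x y z : G}

theorem mem_dc : y ∈ (B : Set G) * {x} * (B : Set G) ↔ DCRel B x y := by
  constructor
  · rintro ⟨_, ⟨b, hb, _, rfl, rfl⟩, c, hc, rfl⟩
    exact ⟨b, hb, c, hc, rfl⟩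
  · rintro ⟨b, hb, c, hc, rfl⟩
    exact ⟨_, ⟨b, hb, _, rfl, rfl⟩, c, hc, rfl⟩

theorem DCRel.symm (h : DCRel B x y) : DCRel B y x := by
  obtain ⟨b, hb, c, hc, rfl⟩ := h
  exact ⟨b⁻¹, B.inv_mem hb, c⁻¹, B.inv_mem hc, by group⟩

theorem DCRel.trans (h : DCRel B x y) (h' : DCRel B y z) : DCRel B x z := by
  obtain ⟨b, hb, c, hc, rfl⟩ := h
  obtain ⟨b', hb', c', hc', rfl⟩ := h'
  exact ⟨b' * b, B.mul_mem hb' hb, c * c', B.mul_mem hc hc', by group⟩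

theorem DCRel.refl (x : G) : DCRel B x x := ⟨1, B.one_mem, 1, B.one_mem, by simp⟩

theorem DCRel.inv (h : DCRel B x y) : DCRel B x⁻¹ y⁻¹ := by
  obtain ⟨b, hb, c, hc, rfl⟩ := h
  exact ⟨c⁻¹, B.inv_mem hc, b⁻¹, B.inv_mem hb, by group⟩

theorem dc_mul : ((B : Set G) * {x} * (B : Set G)) * ((B : Set G) * {y} * (B : Set G)) =
    {z | ∃ b ∈ B, DCRel B (x * b * y) z} := by
  ext z
  constructor
  · rintro ⟨u, hu, v, hv, rfl⟩
    obtain ⟨b, hb, c, hc, rfl⟩ := mem_dc.1 hu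
    obtain ⟨b', hb', c', hc', rfl⟩ := mem_dc.1 hv
    exact ⟨c * b', B.mul_mem hc hb', b, hb, c', hc', by group⟩
  · rintro ⟨b, hb, c, hc, d, hd, rfl⟩
    exact ⟨c * x * b, mem_dc.2 ⟨c, hc, b, hb, rfl⟩, y * d,
      mem_dc.2 ⟨1, B.one_mem, d, hd, by group⟩, by group⟩
end DC

section Main
variable {G : Type*} [Group G] {B N : Subgroup G} [hH : (B.subgroupOf N).Normal]
  {I : Type*} {s : I → N ⧸ B.subgroupOf N}

theorem dc_of_mk {n n' : N} (h : (QuotientGroup.mk n : N ⧸ B.subgroupOf N) = QuotientGroup.mk n') :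
    DCRel B (n : G) n' := by
  rw [QuotientGroup.eq, Subgroup.mem_subgroupOf] at h
  exact ⟨1, B.one_mem, _, h, by simp⟩

theorem bn_right
    (axSq : ∀ i, s i * s i = 1)
    (ax : ∀ (i : I) (ni n : N), QuotientGroup.mk ni = s i → ∀ b ∈ B,
      DCRel B ((ni : G) * n) (ni * b * n) ∨ DCRel B (n : G) (ni * b * n))
    (i : I) (ni n : N) (h : QuotientGroup.mk ni = s i) (b : G) (hb : b ∈ B) :
      DCRel B ((n : G) * ni) (n * b * ni) ∨ DCRel B (n : G) (n * b * ni) := by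
  have h' : (QuotientGroup.mk ni⁻¹ : N ⧸ B.subgroupOf N) = s i := by
    rw [QuotientGroup.mk_inv, h, inv_eq_of_mul_eq_one_left (axSq i)]
  have e : (n : G) * b * ni = ((ni⁻¹ : N) * b⁻¹ * (n⁻¹ : N) : G)⁻¹ := by
    push_cast; group
  rw [e]
  rcases ax i ni⁻¹ n⁻¹ h' b⁻¹ (B.inv_mem hb) with h1 | h1
  · left; simpa using h1.inv
  · right; simpa using h1.inv

theorem bn_inj (axGen : Subgroup.closure (Set.range s) = ⊤)
    (axSq : ∀ i, s i * s i = 1)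
    (ax : ∀ (i : I) (ni n : N), QuotientGroup.mk ni = s i → ∀ b ∈ B,
      DCRel B ((ni : G) * n) (ni * b * n) ∨ DCRel B (n : G) (ni * b * n)) (k : ℕ) :
    ∀ n n' : N, wordLength (Set.range s) (QuotientGroup.mk n) = k →
      k ≤ wordLength (Set.range s) (QuotientGroup.mk n') → DCRel B (n : G) n' →
      (QuotientGroup.mk n : N ⧸ B.subgroupOf N) = QuotientGroup.mk n' := by
  induction k with
  | zero =>
    intro n n' h _ hR
    have h1 := wl_zero axGen axSq h
    rw [h1]
    symm
    rw [QuotientGroup.eq_one_iff, Subgroup.mem_subgroupOf] at h1 ⊢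
    obtain ⟨b, hb, c, hc, e⟩ := hR
    rw [e]
    exact B.mul_mem (B.mul_mem hb h1) hc
  | succ k ih =>
    intro n n' h h' hR
    obtain ⟨i, hi⟩ := wl_succ axGen axSq h
    obtain ⟨ni, hni⟩ := QuotientGroup.mk_surjective (s i)
    have hv : wordLength (Set.range s) (QuotientGroup.mk (ni * n)) = k := by
      rw [QuotientGroup.mk_mul, hni, hi]
    obtain ⟨b, hb, c, hc, e⟩ := hR.symm
    have hR2 : DCRel B ((ni : G) * b * n') ((ni * n : N) : G) :=
      ⟨1, B.one_mem, c, hc, by push_cast; rw [e]; group⟩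
    have h5 := wl_mul_left axGen axSq i (s i * QuotientGroup.mk n')
    rw [← mul_assoc, axSq, one_mul] at h5
    rcases ax i ni n' hni b hb with h1 | h1
    · have := ih (ni * n) (ni * n') hv (by rw [QuotientGroup.mk_mul, hni]; omega)
        (by simpa using (h1.trans hR2).symm)
      simpa using this
    · have := ih (ni * n) n' hv (by omega) (h1.trans hR2).symm
      rw [this] at hv
      omega

theorem bn_inj' (axGen : Subgroup.closure (Set.range s) = ⊤)
    (axSq : ∀ i, s i * s i = 1)
    (ax : ∀ (i : I) (ni n : N), QuotientGroup.mk ni = s i → ∀ b ∈ B,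
      DCRel B ((ni : G) * n) (ni * b * n) ∨ DCRel B (n : G) (ni * b * n))
    (n n' : N) (hR : DCRel B (n : G) n') :
      (QuotientGroup.mk n : N ⧸ B.subgroupOf N) = QuotientGroup.mk n' := by
  rcases le_total (wordLength (Set.range s) (QuotientGroup.mk n))
    (wordLength (Set.range s) (QuotientGroup.mk n')) with h | h
  · exact bn_inj axGen axSq ax _ n n' rfl h hR
  · exact (bn_inj axGen axSq ax _ n' n rfl h hR.symm).symm

theorem bn_up (axGen : Subgroup.closure (Set.range s) = ⊤)
    (axSq : ∀ i, s i * s i = 1) (hne : ∀ i, s i ≠ 1)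
    (ax : ∀ (i : I) (ni n : N), QuotientGroup.mk ni = s i → ∀ b ∈ B,
      DCRel B ((ni : G) * n) (ni * b * n) ∨ DCRel B (n : G) (ni * b * n))
    (i : I) (ni : N) (hni : QuotientGroup.mk ni = s i) (k : ℕ) :
    ∀ n : N, wordLength (Set.range s) (QuotientGroup.mk n) = k →
      k ≤ wordLength (Set.range s) (s i * QuotientGroup.mk n) → ∀ b ∈ B,
      ¬ DCRel B (n : G) (ni * b * n) := by
  induction k with
  | zero =>
    intro n h _ b hb hR
    have h1 := wl_zero axGen axSq h
    rw [QuotientGroup.eq_one_iff, Subgroup.mem_subgroupOf] at h1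
    apply hne i
    rw [← hni, QuotientGroup.eq_one_iff, Subgroup.mem_subgroupOf]
    obtain ⟨c, hc, d, hd, e⟩ := hR
    have : (ni : G) = c * n * d * (n : G)⁻¹ * b⁻¹ := by rw [← e]; group
    rw [this]
    exact B.mul_mem (B.mul_mem (B.mul_mem (B.mul_mem hc h1) hd) (B.inv_mem h1)) (B.inv_mem hb)
  | succ k ih =>
    intro n h h' b hb hR
    obtain ⟨j, hj⟩ := wl_succ_right axGen axSq h
    obtain ⟨nj, hnj⟩ := QuotientGroup.mk_surjective (s j)
    have hv : wordLength (Set.range s) (QuotientGroup.mk (n * nj)) = k := by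
      rw [QuotientGroup.mk_mul, hnj, hj]
    have h5 := wl_mul_right axGen axSq j (s i * (QuotientGroup.mk (n * nj)))
    rw [QuotientGroup.mk_mul, hnj, ← mul_assoc, mul_assoc _ (s j), axSq, mul_one] at h5
    have h6 := ih (n * nj) hv (by rw [QuotientGroup.mk_mul, hnj, ← mul_assoc]; omega) b hb
    have h7 := (ax i ni (n * nj) hni b hb).resolve_right h6
    obtain ⟨c, hc, d, hd, e⟩ := hR
    have h8 : DCRel B ((n : G) * d * nj) (ni * b * (n * nj : N)) :=
      ⟨c, hc, 1, B.one_mem, by push_cast; rw [← mul_assoc, e]; group⟩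
    rcases bn_right axSq ax j nj n hnj d hd with h9 | h9
    · have := bn_inj' axGen axSq ax (ni * (n * nj)) (n * nj)
        (by simpa using h7.trans (h9.trans h8).symm)
      rw [QuotientGroup.mk_mul, hni] at this
      exact hne i (by simpa using this)
    · have := bn_inj' axGen axSq ax (ni * (n * nj)) n
        (by simpa using h7.trans (h9.trans h8).symm)
      have e2 : s i * QuotientGroup.mk n = QuotientGroup.mk (n * nj) := by
        rw [← this, QuotientGroup.mk_mul, hni, ← mul_assoc, axSq, one_mul]
      rw [e2, hv] at h'
      omega

theorem bn_down (axGen : Subgroup.closure (Set.range s) = ⊤)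
    (axSq : ∀ i, s i * s i = 1) (hne : ∀ i, s i ≠ 1)
    (axNotB : ∀ (i : I) (ni : N), QuotientGroup.mk ni = s i →
      ({(ni : G)} : Set G) * (B : Set G) * {(ni : G)} ≠ (B : Set G))
    (ax : ∀ (i : I) (ni n : N), QuotientGroup.mk ni = s i → ∀ b ∈ B,
      DCRel B ((ni : G) * n) (ni * b * n) ∨ DCRel B (n : G) (ni * b * n))
    (i : I) (ni : N) (hni : QuotientGroup.mk ni = s i) (n : N)
    (hl : wordLength (Set.range s) (s i * QuotientGroup.mk n) ≤
      wordLength (Set.range s) (QuotientGroup.mk n)) : ∃ b ∈ B, DCRel B (n : G) (ni * b * n) := by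
  have hsq : (ni : G) * ni ∈ B := by
    have : (QuotientGroup.mk (ni * ni) : N ⧸ B.subgroupOf N) = 1 := by
      rw [QuotientGroup.mk_mul, hni, axSq]
    rw [QuotientGroup.eq_one_iff, Subgroup.mem_subgroupOf] at this
    simpa using this
  have key : ∃ b ∈ B, DCRel B (ni : G) (ni * b * ni) := by
    by_contra hcon
    push Not at hcon
    have hall : ∀ b ∈ B, (ni : G) * b * ni ∈ B := by
      intro b hb
      obtain ⟨c, hc, d, hd, e⟩ := (ax i ni ni hni b hb).resolve_right (hcon b hb)
      rw [e]
      exact B.mul_mem (B.mul_mem hc hsq) hd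
    apply axNotB i ni hni
    ext x
    constructor
    · rintro ⟨_, ⟨_, rfl, b, hb, rfl⟩, _, rfl, rfl⟩
      exact hall b hb
    · intro hx
      refine ⟨_, ⟨_, rfl, (ni : G)⁻¹ * x * (ni : G)⁻¹, ?_, rfl⟩, _, rfl, ?_⟩
      · have : (ni : G)⁻¹ * x * (ni : G)⁻¹ =
            (ni * ni : G)⁻¹ * (ni * x * ni) * (ni * ni : G)⁻¹ := by group
        rw [this]
        exact B.mul_mem (B.mul_mem (B.inv_mem hsq) (hall x hx)) (B.inv_mem hsq)
      · simp only; group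
  obtain ⟨b, hb, c, hc, d, hd, e⟩ := key
  refine ⟨b, hb, ?_⟩
  have hm : (QuotientGroup.mk (ni⁻¹ * n) : N ⧸ B.subgroupOf N) = s i * QuotientGroup.mk n := by
    rw [QuotientGroup.mk_mul, QuotientGroup.mk_inv, hni, inv_eq_of_mul_eq_one_left (axSq i)]
  have h1 := bn_up axGen axSq hne ax i ni hni _ (ni⁻¹ * n) rfl
    (by rw [hm, ← mul_assoc, axSq, one_mul]; exact hl) d hd
  have h2 := (ax i ni (ni⁻¹ * n) hni d hd).resolve_right h1
  have h3 : DCRel B (n : G) (ni * d * (ni⁻¹ * n : N)) := by simpa using h2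
  refine h3.trans ⟨c, hc, 1, B.one_mem, ?_⟩
  have : (ni : G) * b * n = (ni * b * ni) * ((ni : G)⁻¹ * n) := by group
  rw [this, e]; push_cast; group

theorem bn_left_final (axGen : Subgroup.closure (Set.range s) = ⊤)
    (axSq : ∀ i, s i * s i = 1)
    (axNotB : ∀ (i : I) (ni : N), QuotientGroup.mk ni = s i →
      ({(ni : G)} : Set G) * (B : Set G) * {(ni : G)} ≠ (B : Set G))
    (axProd : ∀ (i : I) (ni n : N), QuotientGroup.mk ni = s i →
      ({(ni : G)} : Set G) * (B : Set G) * {(n : G)} ⊆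
        (B : Set G) * {((ni * n : N) : G)} * (B : Set G) ∪
          (B : Set G) * {(n : G)} * (B : Set G))
    (i : I) (n ni : N) (hni : QuotientGroup.mk ni = s i) :
    (wordLength (Set.range s) (s i * QuotientGroup.mk n) =
        wordLength (Set.range s) (QuotientGroup.mk n) + 1 →
          ((B : Set G) * {(ni : G)} * (B : Set G)) *
              ((B : Set G) * {(n : G)} * (B : Set G)) =
            (B : Set G) * {((ni * n : N) : G)} * (B : Set G)) ∧
        (wordLength (Set.range s) (s i * QuotientGroup.mk n) + 1 =
          wordLength (Set.range s) (QuotientGroup.mk n) →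
          ((B : Set G) * {(ni : G)} * (B : Set G)) *
              ((B : Set G) * {(n : G)} * (B : Set G)) =
            (B : Set G) * {((ni * n : N) : G)} * (B : Set G) ∪
              (B : Set G) * {(n : G)} * (B : Set G)) := by
  have ax : ∀ (i : I) (ni n : N), QuotientGroup.mk ni = s i → ∀ b ∈ B,
      DCRel B ((ni : G) * n) (ni * b * n) ∨ DCRel B (n : G) (ni * b * n) := by
    intro i ni n h b hb
    have := axProd i ni n h ⟨_, ⟨_, rfl, b, hb, rfl⟩, _, rfl, rfl⟩
    rcases this with h | h
    · left; simpa using mem_dc.1 h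
    · right; exact mem_dc.1 h
  have hne : ∀ i, s i ≠ 1 := by
    intro i h
    apply axNotB i 1 (by rw [h]; rfl)
    simp
  have hmul : DCRel B ((ni * n : N) : G) (ni * 1 * n) := by simpa using DCRel.refl _
  rw [dc_mul]
  constructor
  · intro hl
    ext z
    rw [mem_dc]
    constructor
    · rintro ⟨b, hb, hz⟩
      have h1 := bn_up axGen axSq hne ax i ni hni _ n rfl (by omega) b hb
      have h2 := (ax i ni n hni b hb).resolve_right h1
      simpa using h2.trans hz
    · intro hz
      exact ⟨1, B.one_mem, hmul.symm.trans hz⟩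
  · intro hl
    ext z
    rw [Set.mem_union, mem_dc, mem_dc]
    constructor
    · rintro ⟨b, hb, hz⟩
      rcases ax i ni n hni b hb with h2 | h2
      · left; simpa using h2.trans hz
      · right; exact h2.trans hz
    · rintro (hz | hz)
      · exact ⟨1, B.one_mem, hmul.symm.trans hz⟩
      · obtain ⟨b, hb, h⟩ := bn_down axGen axSq hne axNotB ax i ni hni n (by omega)
        exact ⟨b, hb, h.symm.trans hz⟩

theorem dc_inv (x : G) : ((B : Set G) * {x} * (B : Set G))⁻¹ =
    (B : Set G) * {x⁻¹} * (B : Set G) := by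
  ext z
  rw [Set.mem_inv, mem_dc, mem_dc]
  exact ⟨fun h => by simpa using h.inv, fun h => by simpa using h.inv⟩

end Main

/-- Multiplication rules for double cosets of `B` in a group `G`
with a `BN`-pair: for `w ∈ W` and a generator `sᵢ`, with `n, nᵢ ∈ N` preimages of `w`
and `sᵢ` respectively, if `ℓ(w sᵢ) = ℓ(w) + 1` then `(BwB)(BsᵢB) = B(wsᵢ)B`, and if
`ℓ(w sᵢ) = ℓ(w) - 1` then `(BwB)(BsᵢB) = B(wsᵢ)B ∪ BwB`; analogously on the left. -/
theorem BN_pair_dcoset_mul_simple {G : Type*} [Group G] (B N : Subgroup G)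
    [hH : (B.subgroupOf N).Normal]
    {I : Type*} (s : I → N ⧸ B.subgroupOf N)
    -- (i) G is generated by B ∪ N
    (axBN : Subgroup.closure ((B : Set G) ∪ (N : Set G)) = ⊤)
    -- (iii) the Weyl group is generated by the involutions `s i`
    (axGen : Subgroup.closure (Set.range s) = ⊤)
    (axSq : ∀ i, s i * s i = 1)
    -- (iv) `nᵢ B nᵢ ≠ B` for every preimage `nᵢ` of `s i`
    (axNotB : ∀ (i : I) (ni : N), QuotientGroup.mk ni = s i →
      ({(ni : G)} : Set G) * (B : Set G) * {(ni : G)} ≠ (B : Set G))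
    -- (v) `nᵢ B n ⊆ B nᵢ n B ∪ B n B`
    (axProd : ∀ (i : I) (ni n : N), QuotientGroup.mk ni = s i →
      ({(ni : G)} : Set G) * (B : Set G) * {(n : G)} ⊆
        (B : Set G) * {((ni * n : N) : G)} * (B : Set G) ∪
          (B : Set G) * {(n : G)} * (B : Set G)) :
    ∀ (i : I) (w : N ⧸ B.subgroupOf N) (n ni : N),
      QuotientGroup.mk n = w → QuotientGroup.mk ni = s i →
      ((wordLength (Set.range s) (w * s i) = wordLength (Set.range s) w + 1 →
          ((B : Set G) * {(n : G)} * (B : Set G)) *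
              ((B : Set G) * {(ni : G)} * (B : Set G)) =
            (B : Set G) * {((n * ni : N) : G)} * (B : Set G)) ∧
        (wordLength (Set.range s) (w * s i) + 1 = wordLength (Set.range s) w →
          ((B : Set G) * {(n : G)} * (B : Set G)) *
              ((B : Set G) * {(ni : G)} * (B : Set G)) =
            (B : Set G) * {((n * ni : N) : G)} * (B : Set G) ∪
              (B : Set G) * {(n : G)} * (B : Set G)) ∧
        (wordLength (Set.range s) (s i * w) = wordLength (Set.range s) w + 1 →
          ((B : Set G) * {(ni : G)} * (B : Set G)) *
              ((B : Set G) * {(n : G)} * (B : Set G)) =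
            (B : Set G) * {((ni * n : N) : G)} * (B : Set G)) ∧
        (wordLength (Set.range s) (s i * w) + 1 = wordLength (Set.range s) w →
          ((B : Set G) * {(ni : G)} * (B : Set G)) *
              ((B : Set G) * {(n : G)} * (B : Set G)) =
            (B : Set G) * {((ni * n : N) : G)} * (B : Set G) ∪
              (B : Set G) * {(n : G)} * (B : Set G))) := by
  intro i w n ni hw hni
  subst hw
  have hni' : (QuotientGroup.mk ni⁻¹ : N ⧸ B.subgroupOf N) = s i := by
    rw [QuotientGroup.mk_inv, hni, inv_eq_of_mul_eq_one_left (axSq i)]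
  have hL := bn_left_final axGen axSq axNotB axProd i n ni hni
  have hR := bn_left_final axGen axSq axNotB axProd i n⁻¹ ni⁻¹ hni'
  have e1 : wordLength (Set.range s) (s i * QuotientGroup.mk n⁻¹) =
      wordLength (Set.range s) (QuotientGroup.mk n * s i) := by
    rw [← wl_inv axGen axSq (QuotientGroup.mk n * s i), mul_inv_rev,
      inv_eq_of_mul_eq_one_left (axSq i), QuotientGroup.mk_inv]
  have e2 : wordLength (Set.range s) (QuotientGroup.mk n⁻¹ : N ⧸ B.subgroupOf N) =
      wordLength (Set.range s) (QuotientGroup.mk n) := by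
    rw [QuotientGroup.mk_inv, wl_inv axGen axSq]
  rw [e1, e2] at hR
  have e3 : (((ni⁻¹ * n⁻¹ : N) : G))⁻¹ = ((n * ni : N) : G) := by
    push_cast; group
  have e4 : (((ni⁻¹ : N) : G))⁻¹ = (ni : G) := by simp
  have e5 : (((n⁻¹ : N) : G))⁻¹ = (n : G) := by simp
  refine ⟨fun h => ?_, fun h => ?_, hL.1, hL.2⟩
  · have := congrArg (fun X : Set G => X⁻¹) (hR.1 h)
    beta_reduce at this
    rw [mul_inv_rev, dc_inv, dc_inv, dc_inv, e3, e4, e5] at this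
    exact this
  · have := congrArg (fun X : Set G => X⁻¹) (hR.2 h)
    beta_reduce at this
    rw [mul_inv_rev, Set.union_inv, dc_inv, dc_inv, dc_inv, e3, e4, e5] at this
    exact this
end
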